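/- Let C be a nontrivial linear q-ary code of length n. Then C is completely regular with covering radius ρ = 1 if and only if its dual code C⊥ is equidistant. -/

import Mathlib

open Finset

variable {F : Type*} [Field F] [Fintype F] [DecidableEq F]

/-- The Hamming distance from a vector to a code. -/
noncomputable def distToCode {ι : Type*} [Fintype ι] (C : Set (ι → F)) (x : ι → F) : ℕ :=
  sInf {d : ℕ | ∃ c ∈ C, hammingDist x c = d}

/-- The covering radius of a code: the maximal distance of a vector to the code. -/
noncomputable def coveringRadius {ι : Type*} [Fintype ι] (C : Set (ι → F)) : ℕ :=
  sSup {d : ℕ | ∃ x : ι → F, distToCode C x = d}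

/-- `C` has intersection numbers `b l` (number of neighbours one step further from the code)
and `c l` (number of neighbours one step closer to the code), for every `x` at distance `l`. -/
def HasIntersectionNumbers {ι : Type*} [Fintype ι] (C : Set (ι → F)) (b c : ℕ → ℕ) : Prop :=
  ∀ l : ℕ, ∀ x : ι → F, distToCode C x = l →
    Nat.card {y : ι → F | hammingDist x y = 1 ∧ distToCode C y = l + 1} = b l ∧
    Nat.card {y : ι → F | hammingDist x y = 1 ∧ distToCode C y + 1 = l} = c l

/-- A code is completely regular if it admits intersection numbers. -/
def IsCompletelyRegular {ι : Type*} [Fintype ι] (C : Set (ι → F)) : Prop :=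
  ∃ b c : ℕ → ℕ, HasIntersectionNumbers C b c

/-- The minimum distance of a code. -/
noncomputable def minDist {ι : Type*} [Fintype ι] (C : Set (ι → F)) : ℕ :=
  sInf {d : ℕ | ∃ x ∈ C, ∃ y ∈ C, x ≠ y ∧ hammingDist x y = d}

/-- A code is equidistant if any two distinct codewords are at the same Hamming distance. -/
def IsEquidistant {ι : Type*} [Fintype ι] (C : Set (ι → F)) : Prop :=
  ∃ d : ℕ, ∀ x ∈ C, ∀ y ∈ C, x ≠ y → hammingDist x y = d

/-- The dual of a code, with respect to the standard bilinear form. -/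
def dualSet {ι : Type*} [Fintype ι] (C : Set (ι → F)) : Set (ι → F) :=
  {y | ∀ x ∈ C, ∑ i, x i * y i = 0}

/-- A code of length `n` is antipodal if it contains a word of Hamming weight `n`. -/
def IsAntipodal {ι : Type*} [Fintype ι] (C : Set (ι → F)) : Prop :=
  ∃ v ∈ C, hammingNorm v = Fintype.card ι

/-- A monomial transformation: a coordinate permutation composed with multiplication of
each coordinate by a nonzero scalar. -/
def IsMonomialMap {ι : Type*} (φ : (ι → F) → (ι → F)) : Prop :=
  ∃ (π : Equiv.Perm ι) (s : ι → Fˣ), ∀ x i, φ x i = (s i : F) * x (π i)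

/-- Two codes are monomially equivalent if one is the image of the other under a bijection of
coordinates together with multiplication of each coordinate by a nonzero scalar. -/
def MonomiallyEquivalent {ι κ : Type*} (C : Set (ι → F)) (D : Set (κ → F)) : Prop :=
  ∃ (e : ι ≃ κ) (s : ι → Fˣ),
    (fun (x : ι → F) (j : κ) => (s (e.symm j) : F) * x (e.symm j)) '' C = D

/-- The orbit, under the action of `Aut C` on the cosets of `C`, of the coset of `v`
(realised as the union of all cosets in the orbit). -/
def cosetOrbit {ι : Type*} (C : Submodule F (ι → F)) (v : ι → F) : Set (ι → F) :=
  {w | ∃ φ : (ι → F) → (ι → F), IsMonomialMap φ ∧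
    φ '' (C : Set (ι → F)) = (C : Set (ι → F)) ∧ φ v - w ∈ C}

/-- The number of orbits of the action of `Aut C` on the cosets of `C`. -/
noncomputable def numCosetOrbits {ι : Type*} (C : Submodule F (ι → F)) : ℕ :=
  Nat.card (Set.range (cosetOrbit C))

/-- `H` is a `q`-ary Hamming code with parameter `m ≥ 2`: a perfect
`[(q^m-1)/(q-1), (q^m-1)/(q-1) - m, 3]_q` code with covering radius 1. -/
def IsHammingCode (m : ℕ) {nm : ℕ} (H : Submodule F (Fin nm → F)) : Prop :=
  2 ≤ m ∧ nm = (Fintype.card F ^ m - 1) / (Fintype.card F - 1) ∧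
  Module.finrank F H = nm - m ∧ minDist (H : Set (Fin nm → F)) = 3 ∧
  coveringRadius (H : Set (Fin nm → F)) = 1

/-- The extended code: append an overall parity-check coordinate. -/
def extendedCode {m : ℕ} (D : Set (Fin m → F)) : Set (Fin (m + 1) → F) :=
  {z | (fun i : Fin m => z i.castSucc) ∈ D ∧ ∑ i, z i = 0}

/-- Construction I(u): append `u` free coordinates to every codeword. -/
def appendCode (u : ℕ) {n : ℕ} (C : Set (Fin n → F)) : Set (Fin (n + u) → F) :=
  {z | ∃ c ∈ C, ∃ y : Fin u → F, z = Fin.append c y}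

/-- Construction II(ℓ): codewords are `ℓ`-tuples of blocks whose `λ`-weighted sum lies in `C`. -/
def repeatCode {n ℓ : ℕ} (lam : Fin ℓ → Fˣ) (C : Set (Fin n → F)) :
    Set (Fin ℓ × Fin n → F) :=
  {z | (fun j : Fin n => ∑ i : Fin ℓ, (lam i : F) * z (i, j)) ∈ C}

/-- The code `{(x₁|⋯|x_ℓ|y) : x₁+⋯+x_ℓ ∈ H, y free}` built from a code `H`. -/
def hammingRepeatCode {nm : ℕ} (ℓ u : ℕ) (H : Set (Fin nm → F)) :
    Set ((Fin ℓ × Fin nm) ⊕ Fin u → F) :=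
  {z | (fun j : Fin nm => ∑ i : Fin ℓ, z (Sum.inl (i, j))) ∈ H}

section Helpers

open scoped Matrix

/-- The dual of a linear code, as a linear code. -/
def dualCode {F ι : Type*} [Field F] [Fintype ι] (E : Submodule F (ι → F)) :
    Submodule F (ι → F) where
  carrier := {y | ∀ x ∈ E, x ⬝ᵥ y = 0}
  zero_mem' := by intro x _; simp
  add_mem' := by
    intro a b ha hb x hx
    rw [dotProduct_add, ha x hx, hb x hx, add_zero]
  smul_mem' := by
    intro t a ha x hx
    rw [dotProduct_smul, ha x hx, smul_zero]

theorem mem_dualCode {F ι : Type*} [Field F] [Fintype ι] {E : Submodule F (ι → F)}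
    {y : ι → F} : y ∈ dualCode E ↔ ∀ x ∈ E, x ⬝ᵥ y = 0 := Iff.rfl

theorem card_ker_mul_card {F V : Type*} [Field F] [AddCommGroup V] [Module F V]
    (g : V →ₗ[F] F) (hg : g ≠ 0) :
    Nat.card {v // g v = 0} * Nat.card F = Nat.card V := by
  have h := Submodule.card_eq_card_quotient_mul_card (LinearMap.ker g)
  rw [Nat.card_congr (g.quotKerEquivOfSurjective (LinearMap.surjective hg)).toEquiv] at h
  exact h.symm

theorem card_apply_ne_zero {F V : Type*} [Field F] [Finite F] [AddCommGroup V] [Module F V]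
    [Finite V] (g : V →ₗ[F] F) (hg : g ≠ 0) :
    Nat.card F * Nat.card {v // g v ≠ 0} = (Nat.card F - 1) * Nat.card V := by
  classical
  have := Fintype.ofFinite V
  have h := card_ker_mul_card g hg
  have h2 : Nat.card {v // g v = 0} + Nat.card {v // g v ≠ 0} = Nat.card V := by
    simp only [Nat.card_eq_fintype_card, Fintype.card_subtype]
    exact Finset.card_filter_add_card_filter_not (s := Finset.univ) (fun v => g v = 0)
  obtain ⟨q, hq⟩ : ∃ q, Nat.card F = q + 1 := ⟨Nat.card F - 1, by
    have : 0 < Nat.card F := Nat.card_pos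
    omega⟩
  rw [hq] at h ⊢
  simp only [Nat.add_sub_cancel]
  nlinarith

theorem exists_mem_dualCode_dotProduct_ne_zero {F ι : Type*} [Field F] [Fintype ι]
    {E : Submodule F (ι → F)} {e : ι → F} (he : e ∉ E) :
    ∃ y ∈ dualCode E, e ⬝ᵥ y ≠ 0 := by
  classical
  obtain ⟨f, hf, hE⟩ := Submodule.exists_le_ker_of_notMem he
  have key : ∀ x, x ⬝ᵥ (fun i => f (Pi.single i 1)) = f x := by
    intro x
    conv_rhs => rw [pi_eq_sum_univ' x]
    simp [dotProduct, map_sum]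
  refine ⟨fun i => f (Pi.single i 1), fun x hx => ?_, ?_⟩
  · rw [key]; exact hE hx
  · rwa [key]

/-- Pairing with `e`, as a functional on the dual code of `E`. -/
def dualPairing {F ι : Type*} [Field F] [Fintype ι] (E : Submodule F (ι → F)) (e : ι → F) :
    dualCode E →ₗ[F] F where
  toFun y := e ⬝ᵥ (y : ι → F)
  map_add' := by intros; simp [dotProduct_add]
  map_smul' := by intros; simp [dotProduct_smul]

theorem dualPairing_ne_zero {F ι : Type*} [Field F] [Fintype ι] {E : Submodule F (ι → F)}
    {e : ι → F} (he : e ∉ E) : dualPairing E e ≠ 0 := by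
  obtain ⟨y, hy, h⟩ := exists_mem_dualCode_dotProduct_ne_zero he
  intro h0
  exact h (LinearMap.congr_fun h0 ⟨y, hy⟩)

theorem card_dualCode_sup_span {F ι : Type*} [Field F] [Fintype ι] {E : Submodule F (ι → F)}
    {x : ι → F} (hx : x ∉ E) :
    Nat.card (dualCode (E ⊔ F ∙ x)) * Nat.card F = Nat.card (dualCode E) := by
  rw [← card_ker_mul_card _ (dualPairing_ne_zero hx)]
  congr 1
  refine Nat.card_congr
    { toFun := fun y => ⟨⟨y.1, fun z hz => y.2 z (Submodule.mem_sup_left hz)⟩,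
        y.2 x (Submodule.mem_sup_right (Submodule.mem_span_singleton_self x))⟩
      invFun := fun y => ⟨y.1.1, fun z hz => ?_⟩
      left_inv := fun y => rfl
      right_inv := fun y => rfl }
  obtain ⟨u, hu, w, hw, rfl⟩ := Submodule.mem_sup.1 hz
  obtain ⟨t, rfl⟩ := Submodule.mem_span_singleton.1 hw
  have h1 : x ⬝ᵥ y.1.1 = 0 := y.2
  rw [add_dotProduct, y.1.2 u hu, smul_dotProduct, h1, smul_zero, add_zero]

theorem hammingDist_eq_one_iff {F ι : Type*} [Field F] [DecidableEq F] [Fintype ι]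
    [DecidableEq ι] {x y : ι → F} :
    hammingDist x y = 1 ↔ ∃ i, ∃ a : F, a ≠ 0 ∧ y = x + Pi.single i a := by
  rw [hammingDist, Finset.card_eq_one]
  constructor
  · rintro ⟨i, hi⟩
    have h : ∀ j, x j ≠ y j ↔ j = i := fun j => by
      simpa using Finset.ext_iff.1 hi j
    refine ⟨i, y i - x i, sub_ne_zero.2 ((h i).2 rfl).symm, ?_⟩
    ext j
    by_cases hj : j = i
    · subst hj; simp
    · have := (h j).not.2 hj
      push Not at this
      simp [hj, this]
  · rintro ⟨i, a, ha, rfl⟩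
    refine ⟨i, ?_⟩
    ext j
    by_cases hj : j = i
    · subst hj; simp [ha]
    · simp [hj]

theorem single_mem_iff {F ι : Type*} [Field F] [DecidableEq ι] {E : Submodule F (ι → F)}
    {i : ι} {a : F} (ha : a ≠ 0) : Pi.single i a ∈ E ↔ Pi.single i 1 ∈ E := by
  rw [← Submodule.smul_mem_iff E (x := Pi.single i (1 : F)) ha]
  simp [← Pi.single_smul]

/-- The codewords adjacent to a non-codeword `x` correspond to the coordinate directions that
become trivial modulo `C` only after adjoining `x`. -/
theorem card_adjacent_codewords {F ι : Type*} [Field F] [DecidableEq F] [Fintype ι]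
    [DecidableEq ι] {C : Submodule F (ι → F)} {x : ι → F} (hx : x ∉ C) :
    Nat.card {y // hammingDist x y = 1 ∧ y ∈ C} =
      Nat.card {i : ι // Pi.single i (1 : F) ∈ C ⊔ F ∙ x ∧ Pi.single i (1 : F) ∉ C} := by
  have hex : ∀ y : {y // hammingDist x y = 1 ∧ y ∈ C}, ∃ i, ∃ a : F, a ≠ 0 ∧
      y.1 = x + Pi.single i a := fun y => hammingDist_eq_one_iff.1 y.2.1
  choose i a ha hy using hex
  have hnot : ∀ y, Pi.single (i y) (1 : F) ∉ C := fun y h => by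
    rw [← single_mem_iff (ha y)] at h
    have := C.sub_mem y.2.2 h
    rw [hy y, add_sub_cancel_right] at this
    exact hx this
  refine Nat.card_congr (Equiv.ofBijective (fun y => ⟨i y, ?_, hnot y⟩) ⟨?_, ?_⟩)
  · rw [← single_mem_iff (ha y)]
    have : Pi.single (i y) (a y) = y.1 - x := by rw [hy y]; simp
    rw [this]
    exact Submodule.sub_mem _ (Submodule.mem_sup_left y.2.2)
      (Submodule.mem_sup_right (Submodule.mem_span_singleton_self x))
  · intro y z hyz
    have hi : i y = i z := congrArg Subtype.val hyz
    apply Subtype.ext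
    have hsub : y.1 - z.1 = Pi.single (i y) (a y - a z) := by
      rw [hy y, hy z, ← hi, Pi.single_sub]; abel
    by_contra hne
    have ha' : a y - a z ≠ 0 := fun h => hne (by
      rw [h, Pi.single_zero] at hsub; exact sub_eq_zero.1 hsub)
    exact hnot y ((single_mem_iff ha').1 (hsub ▸ C.sub_mem y.2.2 z.2.2))
  · rintro ⟨j, hj, hjC⟩
    obtain ⟨u, hu, w, hw, huw⟩ := Submodule.mem_sup.1 hj
    obtain ⟨t, rfl⟩ := Submodule.mem_span_singleton.1 hw
    have ht : t ≠ 0 := by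
      rintro rfl
      apply hjC
      rw [← huw]; simpa using hu
    have ht' : -t⁻¹ ≠ 0 := neg_ne_zero.2 (inv_ne_zero ht)
    have hmem : x + Pi.single j (-t⁻¹) ∈ C := by
      have : x + Pi.single j (-t⁻¹) = (-t⁻¹) • u := by
        have h1 : Pi.single j (-t⁻¹) = (-t⁻¹) • (Pi.single j 1 : ι → F) := by
          rw [← Pi.single_smul, smul_eq_mul, mul_one]
        rw [h1, ← huw, smul_add, smul_smul]
        simp [ht]
      rw [this]
      exact C.smul_mem _ hu
    refine ⟨⟨x + Pi.single j (-t⁻¹), hammingDist_eq_one_iff.2 ⟨j, _, ht', rfl⟩, hmem⟩, ?_⟩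
    apply Subtype.ext
    set y : {y // hammingDist x y = 1 ∧ y ∈ C} :=
      ⟨x + Pi.single j (-t⁻¹), hammingDist_eq_one_iff.2 ⟨j, _, ht', rfl⟩, hmem⟩
    have h2 : x + Pi.single j (-t⁻¹) = x + Pi.single (i y) (a y) := hy y
    have h3 := congrFun (add_left_cancel h2) (i y)
    by_contra hne
    have hne' : i y ≠ j := hne
    rw [Pi.single_eq_of_ne hne', Pi.single_eq_same] at h3
    exact ha y h3.symm

/-- Double counting of the nonzero entries of the words of a dual code in which all nonzero words
have weight `d`. -/
theorem card_not_mem_mul_of_weight {F ι : Type*} [Field F] [Fintype F] [DecidableEq F] [Fintype ι]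
    [DecidableEq ι] {E : Submodule F (ι → F)} {d : ℕ}
    (hd : ∀ y ∈ dualCode E, y ≠ 0 → hammingNorm y = d) :
    Nat.card {i : ι // Pi.single i (1 : F) ∉ E} *
        ((Nat.card F - 1) * Nat.card (dualCode E)) =
      Nat.card F * ((Nat.card (dualCode E) - 1) * d) := by
  classical
  have hcomm := Finset.sum_card_bipartiteAbove_eq_sum_card_bipartiteBelow
    (s := (Finset.univ : Finset (dualCode E))) (t := (Finset.univ : Finset ι))
    (fun y i => y.1 i ≠ 0)
  have h1 : ∑ y : dualCode E, (Finset.univ.bipartiteAbove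
      (fun (y : dualCode E) i => y.1 i ≠ 0) y).card = (Nat.card (dualCode E) - 1) * d := by
    rw [← Finset.add_sum_erase _ _ (Finset.mem_univ (0 : dualCode E)),
      Finset.sum_congr rfl (g := fun _ => d)]
    · simp [Finset.bipartiteAbove, Finset.card_erase_of_mem]
    · intro y hy
      exact hd y.1 y.2 (by simpa using hy)
  have h2 : ∀ i : ι, Nat.card F * (Finset.univ.bipartiteBelow
      (fun (y : dualCode E) i => y.1 i ≠ 0) i).card =
      if Pi.single i (1 : F) ∉ E then (Nat.card F - 1) * Nat.card (dualCode E) else 0 := by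
    intro i
    by_cases hi : Pi.single i (1 : F) ∈ E
    · rw [if_neg (not_not.2 hi), Finset.card_eq_zero.2, mul_zero]
      refine Finset.filter_eq_empty_iff.2 fun y _ => ?_
      simpa using y.2 _ hi
    · rw [if_pos hi, ← card_apply_ne_zero _ (dualPairing_ne_zero hi), Nat.card_eq_fintype_card (α := Subtype _),
        Fintype.card_subtype]
      simp [Finset.bipartiteBelow, dualPairing]
  rw [← h1, hcomm, Finset.mul_sum, Finset.sum_congr rfl fun i _ => h2 i, ← Finset.sum_filter,
    Finset.sum_const, smul_eq_mul, Nat.card_eq_fintype_card (α := Subtype _), Fintype.card_subtype]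

theorem card_adjacent_codewords_eq_of_weight {F ι : Type*} [Field F] [Fintype F] [DecidableEq F]
    [Fintype ι] {C : Submodule F (ι → F)} {d : ℕ}
    (hd : ∀ y ∈ dualCode C, y ≠ 0 → hammingNorm y = d) {x x' : ι → F} (hx : x ∉ C)
    (hx' : x' ∉ C) :
    Nat.card {y // hammingDist x y = 1 ∧ y ∈ C} =
      Nat.card {y // hammingDist x' y = 1 ∧ y ∈ C} := by
  classical
  have hq : 1 < Nat.card F := Finite.one_lt_card
  have hsplit : ∀ z, z ∉ C → Nat.card {y // hammingDist z y = 1 ∧ y ∈ C} +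
      Nat.card {i : ι // Pi.single i (1 : F) ∉ C ⊔ F ∙ z} =
      Nat.card {i : ι // Pi.single i (1 : F) ∉ C} := by
    intro z hz
    rw [card_adjacent_codewords hz]
    simp only [Nat.card_eq_fintype_card, Fintype.card_subtype]
    rw [← Finset.card_filter_add_card_filter_not (s := {i : ι | Pi.single i (1 : F) ∉ C})
      (fun i => Pi.single i (1 : F) ∈ C ⊔ F ∙ z), Finset.filter_filter, Finset.filter_filter]
    congr 2
    · ext i; simp [and_comm]
    · ext i
      simp only [Finset.mem_filter, Finset.mem_univ, true_and]
      exact ⟨fun h => ⟨fun h' => h (Submodule.mem_sup_left h'), h⟩, fun h => h.2⟩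
  have hcard : Nat.card (dualCode (C ⊔ F ∙ x)) = Nat.card (dualCode (C ⊔ F ∙ x')) :=
    Nat.eq_of_mul_eq_mul_right (by omega : 0 < Nat.card F)
      ((card_dualCode_sup_span hx).trans (card_dualCode_sup_span hx').symm)
  have hw : ∀ z, ∀ y ∈ dualCode (C ⊔ F ∙ z), y ≠ 0 → hammingNorm y = d := fun z y hy =>
    hd y fun u hu => hy u (Submodule.mem_sup_left hu)
  have e := card_not_mem_mul_of_weight (hw x)
  rw [hcard, ← card_not_mem_mul_of_weight (hw x')] at e
  have hpos : 0 < (Nat.card F - 1) * Nat.card (dualCode (C ⊔ F ∙ x')) :=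
    Nat.mul_pos (by omega) Nat.card_pos
  have e' := Nat.eq_of_mul_eq_mul_right hpos e
  have := hsplit x hx
  have := hsplit x' hx'
  omega

/-- Double counting of the adjacent pairs formed by a codeword and a word not orthogonal
to `y`. -/
theorem card_mul_hammingNorm_eq {F ι : Type*} [Field F] [Fintype F] [DecidableEq F] [Fintype ι]
    {C : Submodule F (ι → F)} {c : ℕ}
    (hc : ∀ x, x ∉ C → Nat.card {y // hammingDist x y = 1 ∧ y ∈ C} = c) {y : ι → F}
    (hy : y ∈ dualCode C) (hy0 : y ≠ 0) :
    Nat.card F * (Nat.card C * (hammingNorm y * (Nat.card F - 1))) =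
      (Nat.card F - 1) * Nat.card (ι → F) * c := by
  classical
  have hcomm := Finset.sum_card_bipartiteAbove_eq_sum_card_bipartiteBelow
    (s := ({x | x ⬝ᵥ y ≠ 0} : Finset (ι → F))) (t := ({u | u ∈ C} : Finset (ι → F)))
    (fun x u => hammingDist x u = 1)
  have h1 : ∀ x ∈ ({x | x ⬝ᵥ y ≠ 0} : Finset (ι → F)),
      (({u | u ∈ C} : Finset (ι → F)).bipartiteAbove (fun x u => hammingDist x u = 1) x).card
        = c := by
    intro x hx
    rw [← hc x fun h => (Finset.mem_filter.1 hx).2 (hy x h), Nat.card_eq_fintype_card,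
      Fintype.card_subtype, Finset.bipartiteAbove, Finset.filter_filter]
    congr 1
    ext u; simp [and_comm]
  have h2 : ∀ u ∈ ({u | u ∈ C} : Finset (ι → F)),
      (({x | x ⬝ᵥ y ≠ 0} : Finset (ι → F)).bipartiteBelow (fun x u => hammingDist x u = 1) u).card
        = hammingNorm y * (Nat.card F - 1) := by
    intro u hu
    have hu' : u ⬝ᵥ y = 0 := hy u (Finset.mem_filter.1 hu).2
    have hF : Nat.card F - 1 = ({a | a ≠ 0} : Finset F).card := by
      rw [Finset.filter_ne' Finset.univ (0 : F), Finset.card_erase_of_mem (Finset.mem_univ _),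
        Finset.card_univ, Nat.card_eq_fintype_card]
    rw [hF, hammingNorm, ← Finset.card_product]
    symm
    refine Finset.card_bij (fun p _ => u + Pi.single p.1 p.2) ?_ ?_ ?_
    · rintro ⟨i, a⟩ h
      simp only [Finset.mem_product, Finset.mem_filter, Finset.mem_univ, true_and] at h
      simp only [Finset.bipartiteBelow, Finset.mem_filter, Finset.mem_univ, true_and]
      refine ⟨?_, ?_⟩
      · rw [add_dotProduct, hu', zero_add, single_dotProduct]
        exact mul_ne_zero h.2 h.1
      · rw [hammingDist_comm]
        exact hammingDist_eq_one_iff.2 ⟨i, a, h.2, rfl⟩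
    · rintro ⟨i, a⟩ h ⟨j, b⟩ h' hij
      simp only [Finset.mem_product, Finset.mem_filter, Finset.mem_univ, true_and] at h h'
      have h3 := add_left_cancel hij
      have hij : i = j := by
        by_contra hne
        have := congrFun h3 i
        rw [Pi.single_eq_same, Pi.single_eq_of_ne hne] at this
        exact h.2 this
      subst hij
      exact congrArg _ (Pi.single_injective _ h3)
    · intro x hx
      simp only [Finset.bipartiteBelow, Finset.mem_filter, Finset.mem_univ, true_and] at hx
      rw [hammingDist_comm] at hx
      obtain ⟨i, a, ha, rfl⟩ := hammingDist_eq_one_iff.1 hx.2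
      rw [add_dotProduct, hu', zero_add, single_dotProduct] at hx
      exact ⟨(i, a), by simpa [ha] using right_ne_zero_of_mul hx.1, rfl⟩
  rw [Finset.sum_congr rfl h1, Finset.sum_congr rfl h2, Finset.sum_const, Finset.sum_const,
    smul_eq_mul, smul_eq_mul] at hcomm
  let g : (ι → F) →ₗ[F] F :=
    { toFun := fun x => x ⬝ᵥ y
      map_add' := fun a b => add_dotProduct a b y
      map_smul' := fun t a => smul_dotProduct t a y }
  have hg : g ≠ 0 := by
    intro h
    apply hy0
    ext i
    have := LinearMap.congr_fun h (Pi.single i 1)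
    simpa [g] using this
  have h3 := card_apply_ne_zero g hg
  have h4 : Nat.card {v // g v ≠ 0} = ({x | x ⬝ᵥ y ≠ 0} : Finset (ι → F)).card := by
    rw [Nat.card_eq_fintype_card, Fintype.card_subtype]; rfl
  have h5 : Nat.card C = ({u | u ∈ C} : Finset (ι → F)).card := by
    rw [Nat.card_eq_fintype_card]; exact Fintype.card_subtype _
  rw [← h3, h4, h5, ← hcomm, mul_assoc]

theorem distToCode_eq_zero_iff {F ι : Type*} [Field F] [Fintype F] [DecidableEq F] [Fintype ι]
    {C : Submodule F (ι → F)} {x : ι → F} : distToCode (C : Set (ι → F)) x = 0 ↔ x ∈ C := by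
  rw [distToCode, Nat.sInf_eq_zero]
  constructor
  · rintro (⟨c, hc, h⟩ | h)
    · rw [hammingDist_eq_zero] at h
      exact h ▸ hc
    · exact absurd h (Set.Nonempty.ne_empty ⟨hammingDist x 0, 0, C.zero_mem, rfl⟩)
  · intro h
    exact Or.inl ⟨x, h, hammingDist_self x⟩

theorem distToCode_le {F ι : Type*} [Field F] [Fintype F] [DecidableEq F] [Fintype ι]
    {C : Set (ι → F)} {x c : ι → F} (hc : c ∈ C) : distToCode C x ≤ hammingDist x c :=
  Nat.sInf_le ⟨c, hc, rfl⟩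

theorem coveringRadius_eq_one_iff {F ι : Type*} [Field F] [Fintype F] [DecidableEq F] [Fintype ι]
    {C : Submodule F (ι → F)} (hC : ∃ x, x ∉ C) :
    coveringRadius (C : Set (ι → F)) = 1 ↔ ∀ x, distToCode (C : Set (ι → F)) x ≤ 1 := by
  have hbdd : BddAbove {d : ℕ | ∃ x : ι → F, distToCode (C : Set (ι → F)) x = d} :=
    (Set.finite_range (distToCode (C : Set (ι → F)))).bddAbove
  constructor
  · intro h x
    rw [← h]
    exact le_csSup hbdd ⟨x, rfl⟩
  · intro h
    obtain ⟨x, hx⟩ := hC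
    apply le_antisymm
    · refine csSup_le ⟨_, x, rfl⟩ ?_
      rintro _ ⟨z, rfl⟩
      exact h z
    · have h1 : distToCode (C : Set (ι → F)) x ≠ 0 := distToCode_eq_zero_iff.not.2 hx
      exact (Nat.one_le_iff_ne_zero.2 h1).trans (le_csSup hbdd ⟨x, rfl⟩)

theorem isEquidistant_dualSet_iff {F ι : Type*} [Field F] [Fintype F] [DecidableEq F] [Fintype ι]
    {C : Submodule F (ι → F)} : IsEquidistant (dualSet (C : Set (ι → F))) ↔
      ∃ d, ∀ y ∈ dualCode C, y ≠ 0 → hammingNorm y = d := by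
  refine exists_congr fun d => ⟨fun h y hy hy0 => ?_, fun h x hx y hy hxy => ?_⟩
  · rw [← hammingDist_zero_right]
    exact h y hy 0 (dualCode C).zero_mem hy0
  · rw [hammingDist_comm, hammingDist_eq_hammingNorm, neg_add_eq_sub]
    exact h _ ((dualCode C).sub_mem hx hy) (sub_ne_zero.2 hxy)

/-- A proper linear code is completely regular with covering radius 1 iff every non-codeword is
adjacent to the same positive number of codewords. -/
theorem completelyRegular_coveringRadius_one_iff {F ι : Type*} [Field F] [Fintype F]
    [DecidableEq F] [Fintype ι] {C : Submodule F (ι → F)} (hC : ∃ x, x ∉ C) :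
    (IsCompletelyRegular (C : Set (ι → F)) ∧ coveringRadius (C : Set (ι → F)) = 1) ↔
      ∃ c, 0 < c ∧ ∀ x, x ∉ C → Nat.card {y // hammingDist x y = 1 ∧ y ∈ C} = c := by
  rw [coveringRadius_eq_one_iff hC]
  have hone : ∀ y : ι → F, distToCode (C : Set (ι → F)) y + 1 = 1 ↔ y ∈ C := fun y => by
    rw [← distToCode_eq_zero_iff (C := C)]; omega
  constructor
  · rintro ⟨⟨b, c, h⟩, hle⟩
    have key : ∀ x, x ∉ C → Nat.card {y // hammingDist x y = 1 ∧ y ∈ C} = c 1 := by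
      intro x hx
      have h0 := (distToCode_eq_zero_iff (C := C)).not.2 hx
      rw [← (h 1 x (by have := hle x; omega)).2]
      exact Nat.card_congr (Equiv.subtypeEquivRight fun y => and_congr_right' (hone y).symm)
    refine ⟨c 1, ?_, key⟩
    obtain ⟨x, hx⟩ := hC
    rw [← key x hx]
    have h0 := (distToCode_eq_zero_iff (C := C)).not.2 hx
    have h1 : distToCode (C : Set (ι → F)) x = 1 := by have := hle x; omega
    obtain ⟨y, hy, hxy⟩ : distToCode (C : Set (ι → F)) x ∈
        {d : ℕ | ∃ c ∈ (C : Set (ι → F)), hammingDist x c = d} :=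
      Nat.sInf_mem ⟨_, 0, C.zero_mem, rfl⟩
    have : Nonempty {y // hammingDist x y = 1 ∧ y ∈ C} := ⟨⟨y, hxy.trans h1, hy⟩⟩
    exact Nat.card_pos
  · rintro ⟨c, hc, h⟩
    have hle : ∀ x, distToCode (C : Set (ι → F)) x ≤ 1 := by
      intro x
      by_cases hx : x ∈ C
      · rw [distToCode_eq_zero_iff.2 hx]; exact zero_le_one
      · obtain ⟨⟨y, hy, hyC⟩⟩ := (Nat.card_pos_iff.1 (by rw [h x hx]; exact hc)).1
        exact hy ▸ distToCode_le hyC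
    refine ⟨⟨fun l => if l = 0 then Nat.card {y : ι → F // hammingNorm y = 1 ∧ y ∉ C} else 0,
      fun l => if l = 1 then c else 0, ?_⟩, hle⟩
    rintro l x rfl
    have hdist : ∀ y : ι → F, distToCode (C : Set (ι → F)) y = 1 ↔ y ∉ C := fun y => by
      rw [← distToCode_eq_zero_iff (C := C)]
      have := hle y
      omega
    by_cases hx : x ∈ C
    · rw [distToCode_eq_zero_iff.2 hx]
      refine ⟨?_, by simp⟩
      refine Nat.card_congr ((Equiv.subRight x).subtypeEquiv fun y => ?_)
      have : y - x ∈ C ↔ y ∈ C := ⟨fun h => by simpa using C.add_mem h hx, fun h => C.sub_mem h hx⟩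
      simp [hdist, this, hammingDist_eq_hammingNorm, neg_add_eq_sub]
    · rw [(hdist x).2 hx]
      constructor
      · refine Nat.card_eq_zero.2 ?_
        left
        refine ⟨fun y => ?_⟩
        have := y.2.2
        have := hle y.1
        omega
      · rw [← h x hx]
        exact Nat.card_congr (Equiv.subtypeEquivRight fun y => and_congr_right' (hone y))

theorem exists_single_notMem {F ι : Type*} [Field F] [Finite ι] [DecidableEq ι]
    {C : Submodule F (ι → F)} (hC : ∃ x, x ∉ C) : ∃ i, Pi.single i (1 : F) ∉ C := by
  by_contra! h
  obtain ⟨x, hx⟩ := hC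
  have := Fintype.ofFinite ι
  apply hx
  rw [← Finset.univ_sum_single x]
  refine C.sum_mem fun i _ => ?_
  by_cases h0 : x i = 0
  · rw [h0, Pi.single_zero]; exact C.zero_mem
  · exact (single_mem_iff h0).2 (h i)

end Helpers

/-- a nontrivial linear code is completely regular with covering radius 1
iff its dual is equidistant. -/
theorem completely_regular_rho_one_iff_dual_equidistant
    {F : Type*} [Field F] [Fintype F] [DecidableEq F] {n k : ℕ}
    (C : Submodule F (Fin n → F))
    (hk : Module.finrank F C = k)
    (hk2 : 2 ≤ k) (hkn : k + 2 ≤ n) :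
    (IsCompletelyRegular (C : Set (Fin n → F)) ∧
        coveringRadius (C : Set (Fin n → F)) = 1) ↔
      IsEquidistant (dualSet (C : Set (Fin n → F))) := by
  have hC : ∃ x, x ∉ C := by
    by_contra! h
    rw [(Submodule.eq_top_iff'.2 h : C = ⊤), finrank_top, Module.finrank_fin_fun] at hk
    omega
  rw [completelyRegular_coveringRadius_one_iff hC, isEquidistant_dualSet_iff]
  have hq : 1 < Nat.card F := Finite.one_lt_card
  constructor
  · rintro ⟨c, -, hc⟩
    refine ⟨(Nat.card F - 1) * Nat.card (Fin n → F) * c /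
      (Nat.card F * (Nat.card C * (Nat.card F - 1))), fun y hy hy0 => ?_⟩
    rw [← card_mul_hammingNorm_eq hc hy hy0]
    have hpos : 0 < Nat.card F * (Nat.card C * (Nat.card F - 1)) :=
      Nat.mul_pos (by omega) (Nat.mul_pos Nat.card_pos (by omega))
    refine (Nat.div_eq_of_eq_mul_left hpos ?_).symm
    ring
  · rintro ⟨d, hd⟩
    obtain ⟨i, hi⟩ := exists_single_notMem hC
    refine ⟨_, ?_, fun x hx => card_adjacent_codewords_eq_of_weight hd hx hi⟩
    have : Nonempty {y // hammingDist (Pi.single i (1 : F)) y = 1 ∧ y ∈ C} :=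
      ⟨⟨0, by
        rw [hammingDist_comm]
        exact hammingDist_eq_one_iff.2 ⟨i, 1, one_ne_zero, (zero_add _).symm⟩, C.zero_mem⟩⟩
    exact Nat.card_pos
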